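/- For every real ε > 0 there exists an integer G such that for every integer g ≥ G the set D_g is finite and #D_g ≤ g^{1+ε}. -/

import Mathlib

/-- `N` is a repdigit in base `g` with at least two digits:
`N = d * (g^k - 1)/(g-1)` for some digit `1 ≤ d ≤ g-1` and some `k ≥ 2`. -/
def Repdigit (g N : ℕ) : Prop :=
  0 < N ∧ ∃ d k : ℕ, 1 ≤ d ∧ d ≤ g - 1 ∧ 2 ≤ k ∧ N * (g - 1) = d * (g ^ k - 1)

/-- The set of Diophantine triples with values in the repdigits in base `g`. -/
def DioTriples (g : ℕ) : Set (ℕ × ℕ × ℕ) :=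
  {p | 0 < p.2.2 ∧ p.2.2 < p.2.1 ∧ p.2.1 < p.1 ∧
    Repdigit g (p.1 * p.2.1 + 1) ∧ Repdigit g (p.1 * p.2.2 + 1) ∧
    Repdigit g (p.2.1 * p.2.2 + 1)}

/-! ### The divisor bound -/

theorem succ_le_mul_one_add_pow {y : ℝ} (hy : 0 < y) (k : ℕ) :
    (k + 1 : ℝ) ≤ (1 + 1 / y) * (1 + y) ^ k := by
  have h1 : 1 + (k : ℝ) * y ≤ (1 + y) ^ k := one_add_mul_le_pow (by linarith) k
  have h2 : (1 + 1 / y) * (1 + (k : ℝ) * y) = 1 + k * y + 1 / y + k := by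
    field_simp
    ring
  have h3 : 0 ≤ (k : ℝ) * y := by positivity
  have h4 : 0 < 1 / y := by positivity
  nlinarith [mul_le_mul_of_nonneg_left h1 (by positivity : 0 ≤ 1 + 1 / y)]

/-- For every `η > 0`, the number of divisors of `n` is at most a constant times `n ^ η`. -/
theorem exists_card_divisors_le_rpow {η : ℝ} (hη : 0 < η) :
    ∃ C : ℝ, 0 < C ∧ ∀ n : ℕ, (n.divisors.card : ℝ) ≤ C * (n : ℝ) ^ η := by
  obtain ⟨B, hB⟩ := exists_nat_ge ((2 : ℝ) ^ (1 / η))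
  set y : ℝ := 2 ^ η - 1 with hy
  have hy0 : 0 < y := by
    have := Real.one_lt_rpow (x := 2) (by norm_num) hη
    linarith
  set K : ℝ := 1 + 1 / y with hK
  have hK1 : 1 ≤ K := by
    have : 0 < 1 / y := by positivity
    linarith
  refine ⟨K ^ B, by positivity, fun n => ?_⟩
  rcases eq_or_ne n 0 with rfl | hn
  · simp [Real.zero_rpow hη.ne']
  have hlocal : ∀ p ∈ n.primeFactors, ((n.factorization p + 1 : ℕ) : ℝ) ≤
      (if p < B then K else 1) * ((p : ℝ) ^ n.factorization p) ^ η := by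
    intro p hp
    have hp2 : (2 : ℝ) ≤ p := by exact_mod_cast (Nat.prime_of_mem_primeFactors hp).two_le
    have hcomm : ((p : ℝ) ^ n.factorization p) ^ η = ((p : ℝ) ^ η) ^ n.factorization p := by
      rw [← Real.rpow_natCast, ← Real.rpow_natCast, ← Real.rpow_mul (by positivity),
        ← Real.rpow_mul (by positivity), mul_comm]
    rw [hcomm]
    push_cast
    split_ifs with hpB
    · refine (succ_le_mul_one_add_pow hy0 _).trans ?_
      have : 1 + y ≤ (p : ℝ) ^ η := by
        rw [hy, add_sub_cancel]
        exact Real.rpow_le_rpow (by norm_num) hp2 hη.le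
      gcongr
    · have hp' : (2 : ℝ) ^ (1 / η) ≤ p := hB.trans (by exact_mod_cast not_lt.mp hpB)
      have h2 : (2 : ℝ) ≤ (p : ℝ) ^ η := by
        calc (2 : ℝ) = ((2 : ℝ) ^ (1 / η)) ^ η := by
              rw [← Real.rpow_mul (by norm_num), one_div_mul_cancel hη.ne', Real.rpow_one]
          _ ≤ (p : ℝ) ^ η := Real.rpow_le_rpow (by positivity) hp' hη.le
      have h3 : ((n.factorization p : ℝ) + 1) ≤ 2 ^ n.factorization p := by
        exact_mod_cast Nat.lt_two_pow_self
      rw [one_mul]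
      exact h3.trans (pow_le_pow_left₀ (by norm_num) h2 _)
  have hsmall : (∏ p ∈ n.primeFactors, if p < B then K else 1) ≤ K ^ B := by
    rw [Finset.prod_ite, Finset.prod_const, Finset.prod_const_one, mul_one]
    refine pow_le_pow_right₀ hK1 ?_
    calc _ ≤ (Finset.range B).card := Finset.card_le_card fun p hp => by
          simpa using (Finset.mem_filter.mp hp).2
      _ = B := Finset.card_range B
  have hprod : (∏ p ∈ n.primeFactors, ((p : ℝ) ^ n.factorization p) ^ η) = (n : ℝ) ^ η := by
    rw [Real.finsetProd_rpow _ _ fun p _ => by positivity]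
    congr 1
    conv_rhs => rw [← Nat.prod_factorization_pow_eq_self hn]
    simp [Finsupp.prod]
  calc (n.divisors.card : ℝ) = ∏ p ∈ n.primeFactors, ((n.factorization p + 1 : ℕ) : ℝ) := by
        rw [Nat.card_divisors hn, Nat.cast_prod]
    _ ≤ ∏ p ∈ n.primeFactors,
        (if p < B then K else 1) * ((p : ℝ) ^ n.factorization p) ^ η :=
      Finset.prod_le_prod (fun p _ => by positivity) hlocal
    _ ≤ K ^ B * (n : ℝ) ^ η := by
      rw [Finset.prod_mul_distrib, hprod]
      gcongr

/-! ### Bounding the lengths of the repdigits -/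

/-- `x + 1` is the repdigit of length `n` with digit `d` in base `g`, as an equation in `ℤ`. -/
structure IsRepdigitPred (g x d : ℤ) (n : ℕ) : Prop where
  one_le : 1 ≤ d
  lt : d < g
  two_le : 2 ≤ n
  eq : (g - 1) * x = d * g ^ n - (d + g - 1)

namespace IsRepdigitPred

variable {g a b c x x' d d' d₁ d₂ d₃ : ℤ} {n m n₁ n₂ n₃ : ℕ}

theorem two_le_base (h : IsRepdigitPred g x d n) : 2 ≤ g := by
  linarith [h.one_le, h.lt]

theorem lt_pow (h : IsRepdigitPred g x d n) : x < g ^ n := by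
  have hg := h.two_le_base
  have hp : 0 < g ^ n := by positivity
  have h1 : d * g ^ n ≤ (g - 1) * g ^ n :=
    mul_le_mul_of_nonneg_right (by linarith [h.lt]) hp.le
  refine lt_of_mul_lt_mul_left (a := g - 1) ?_ (by linarith)
  linarith [h.eq, h.one_le]

theorem pow_le (h : IsRepdigitPred g x d n) : g ^ (n - 1) ≤ x := by
  have hg := h.two_le_base
  obtain ⟨k, rfl⟩ : ∃ k, n = k + 2 := ⟨n - 2, by have := h.two_le; omega⟩
  have hp : 0 < g ^ k := by positivity
  refine le_of_mul_le_mul_left (a := g - 1) ?_ (by linarith)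
  rw [h.eq]
  have e1 : g ^ (k + 2 - 1) = g * g ^ k := by
    rw [show k + 2 - 1 = k + 1 by omega]; ring
  have e2 : g ^ (k + 2) = g * (g * g ^ k) := by ring
  rw [e1, e2]
  have h2 : g ≤ g * g ^ k := le_mul_of_one_le_right (by linarith) hp
  nlinarith [mul_nonneg (sub_nonneg.2 h.one_le)
    (by nlinarith : 0 ≤ g * (g * g ^ k) - 1)]

theorem length_le (h : IsRepdigitPred g x d n) (h' : IsRepdigitPred g x' d' m) (hx : x ≤ x') :
    n ≤ m := by
  have h1 : g ^ (n - 1) < g ^ m := (h.pow_le.trans hx).trans_lt h'.lt_pow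
  have := (pow_lt_pow_iff_right₀ (by linarith [h.two_le_base] : 1 < g)).1 h1
  omega

/-- If `a` divides `x` and `x'`, where `x + 1` and `x' + 1` are repdigits of the same length,
then `a` divides the difference of their digits. -/
theorem dvd_digit_sub (h : IsRepdigitPred g (a * b) d n) (h' : IsRepdigitPred g (a * c) d' n) :
    a ∣ d - d' := by
  have hg : g - 1 ≠ 0 := by linarith [h.two_le_base]
  refine ⟨d' * b - d * c, mul_left_cancel₀ hg ?_⟩
  linear_combination d * h'.eq - d' * h.eq

/-- The digit is determined by the length and a divisor `a ≥ g`. -/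
theorem eq_of_base_le (h : IsRepdigitPred g (a * b) d n) (h' : IsRepdigitPred g (a * c) d' n)
    (ha : g ≤ a) : d = d' := by
  have := Int.eq_zero_of_abs_lt_dvd (dvd_digit_sub h h') (by
    rw [abs_lt]; constructor <;> linarith [h.one_le, h.lt, h'.one_le, h'.lt])
  linarith

/-- The two largest products in a triple correspond to repdigits of different lengths. -/
theorem length_ne (h₃ : IsRepdigitPred g (a * b) d₃ n₃) (h₂ : IsRepdigitPred g (a * c) d₂ n₂)
    (hc : 0 < c) (hcb : c < b) (hba : b < a) : n₂ ≠ n₃ := by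
  rintro rfl
  have hg := h₃.two_le_base
  have hp : g * g ≤ g ^ n₂ := by
    rw [← pow_two]; exact pow_le_pow_right₀ (by linarith) h₂.two_le
  have key : (g - 1) * (a * (b - c)) = (d₃ - d₂) * (g ^ n₂ - 1) := by
    linear_combination h₃.eq - h₂.eq
  have hR : 0 < g ^ n₂ - 1 := by nlinarith
  have hpos : 0 < d₃ - d₂ := by
    have h1 : 0 < (g - 1) * (a * (b - c)) :=
      mul_pos (by linarith) (mul_pos (by linarith) (by linarith))
    rw [key] at h1
    exact pos_of_mul_pos_left h1 hR.le
  have hle : a ≤ d₃ - d₂ := Int.le_of_dvd hpos (dvd_digit_sub h₃ h₂)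
  have h2 : a * (g ^ n₂ - 1) ≤ a * ((g - 1) * (b - c)) := by
    calc a * (g ^ n₂ - 1) ≤ (d₃ - d₂) * (g ^ n₂ - 1) := mul_le_mul_of_nonneg_right hle hR.le
      _ = a * ((g - 1) * (b - c)) := by rw [← key]; ring
  have h3 := le_of_mul_le_mul_left h2 (by linarith)
  have h4 : b - c ≤ g - 1 := by linarith [h₃.lt, h₂.one_le]
  nlinarith

theorem digit_add_lt (h : IsRepdigitPred g x d n) : d + g - 1 < g ^ 2 := by
  nlinarith [h.lt, h.two_le_base]

/-- In a triple, `n₃` and `2 * n₂` differ by a bounded amount. -/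
theorem length_close (h₃ : IsRepdigitPred g (a * b) d₃ n₃) (h₂ : IsRepdigitPred g (a * c) d₂ n₂)
    (hc : 0 < c) (hba : b < a) (hn : n₂ < n₃) :
    n₃ ≤ 2 * n₂ ∧ 2 * n₂ ≤ n₃ + 6 := by
  have hg := h₃.two_le_base
  have hg1 : 1 < g := by linarith
  have hd₃ := h₃.one_le
  have hd₂ := h₂.one_le
  have hb : 0 < a * b := lt_of_lt_of_le (by positivity) h₃.pow_le
  have ha0 : 0 < a := by
    have := lt_of_lt_of_le (by positivity) h₂.pow_le
    exact pos_of_mul_pos_left this hc.le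
  have ha2 : g ^ (n₃ - 1) < a * a := h₃.pow_le.trans_lt (by nlinarith)
  have hsq : ∀ k : ℕ, a ≤ g ^ k → n₃ - 1 < k + k := fun k hk => by
    refine (pow_lt_pow_iff_right₀ hg1).1 (ha2.trans_le ?_)
    rw [pow_add]
    exact mul_le_mul hk hk ha0.le (by positivity)
  constructor
  · have h1 : a ≤ g ^ n₂ := by nlinarith [h₂.lt_pow]
    have := hsq n₂ h1
    omega
  · obtain ⟨δ, rfl⟩ : ∃ δ, n₃ = n₂ + (δ + 1) := ⟨n₃ - n₂ - 1, by omega⟩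
    have hgδ : 1 ≤ g ^ δ := one_le_pow₀ hg1.le
    have hdvd : a ∣ d₃ * (d₂ + g - 1) * g ^ (δ + 1) - d₂ * (d₃ + g - 1) := by
      refine ⟨(g - 1) * (d₂ * b - d₃ * g ^ (δ + 1) * c), ?_⟩
      have h3 := h₃.eq
      rw [pow_add] at h3
      linear_combination d₃ * g ^ (δ + 1) * h₂.eq - d₂ * h3
    have hpos : 0 < d₃ * (d₂ + g - 1) * g ^ (δ + 1) - d₂ * (d₃ + g - 1) := by
      have h1 : d₃ + g - 1 ≤ d₃ * g := by nlinarith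
      have h2 : d₂ * (d₃ + g - 1) ≤ d₂ * (d₃ * g) := mul_le_mul_of_nonneg_left h1 (by linarith)
      have h3 : d₃ * (d₂ + g - 1) * g ≤ d₃ * (d₂ + g - 1) * g ^ (δ + 1) := by
        rw [pow_succ']
        refine mul_le_mul_of_nonneg_left (le_mul_of_one_le_right (by linarith) hgδ) ?_
        exact mul_nonneg (by linarith) (by linarith)
      have h4 : 0 < d₃ * (g - 1) * g := by
        refine mul_pos (mul_pos ?_ ?_) ?_ <;> linarith
      nlinarith
    have hle := Int.le_of_dvd hpos hdvd
    have hup : a ≤ g ^ (δ + 4) := by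
      have h1 : d₃ * (d₂ + g - 1) ≤ g * g ^ 2 :=
        mul_le_mul h₃.lt.le h₂.digit_add_lt.le (by linarith) (by linarith)
      have h2 : d₃ * (d₂ + g - 1) * g ^ (δ + 1) ≤ g * g ^ 2 * g ^ (δ + 1) :=
        mul_le_mul_of_nonneg_right h1 (by positivity)
      have h3 : g * g ^ 2 * g ^ (δ + 1) = g ^ (δ + 4) := by ring
      have h4 : 0 ≤ d₂ * (d₃ + g - 1) := mul_nonneg (by linarith) (by linarith)
      linarith
    have := hsq _ hup
    omega

/-- In a triple, the lengths of the repdigits are bounded by an absolute constant. -/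
theorem length_le_thirty (h₃ : IsRepdigitPred g (a * b) d₃ n₃)
    (h₂ : IsRepdigitPred g (a * c) d₂ n₂) (h₁ : IsRepdigitPred g (b * c) d₁ n₁)
    (hc : 0 < c) (hcb : c < b) (hba : b < a) (hn : n₂ < n₃) : n₃ ≤ 30 := by
  obtain ⟨hlow, hhigh⟩ := length_close h₃ h₂ hc hba hn
  obtain ⟨s, hs⟩ : ∃ s, n₃ + s = 2 * n₂ := ⟨2 * n₂ - n₃, by omega⟩
  have hs6 : s ≤ 6 := by omega
  have hg := h₃.two_le_base
  have hg1 : 1 < g := by linarith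
  have hg1' : 1 ≤ g := hg1.le
  have hb0 : 0 < b := by linarith
  have ha0 : 0 < a := by linarith
  have hd₁ := h₁.one_le
  have hd₂ := h₂.one_le
  have hd₃ := h₃.one_le
  have he₁ : 0 < d₁ + g - 1 := by linarith
  have he₂ : 0 < d₂ + g - 1 := by linarith
  have he₃ : 0 < d₃ + g - 1 := by linarith
  have hd₂0 : 0 < d₂ := by linarith
  have hd₃0 : 0 < d₃ := by linarith
  have hs6' : g ^ s ≤ g ^ 6 := pow_le_pow_right₀ hg1' hs6
  have hpow : g ^ n₃ * g ^ s = g ^ n₂ * g ^ n₂ := by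
    rw [← pow_add, hs, two_mul, pow_add]
  have ha2 : g ^ (n₃ - 1) < a * a := h₃.pow_le.trans_lt (by nlinarith)
  set Z := d₃ * (d₂ + g - 1) ^ 2 - d₂ ^ 2 * (d₃ + g - 1) * g ^ s with hZ
  have hA : d₃ * (d₂ + g - 1) ^ 2 ≤ g ^ 10 := by
    calc d₃ * (d₂ + g - 1) ^ 2 ≤ g * (g ^ 2) ^ 2 := by
          gcongr
          · exact h₃.lt.le
          · exact h₂.digit_add_lt.le
      _ = g ^ 5 := by ring
      _ ≤ g ^ 10 := pow_le_pow_right₀ hg1' (by norm_num)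
  have hB : d₂ ^ 2 * (d₃ + g - 1) * g ^ s ≤ g ^ 10 := by
    calc d₂ ^ 2 * (d₃ + g - 1) * g ^ s ≤ g ^ 2 * g ^ 2 * g ^ 6 := by
          gcongr
          · exact h₂.lt.le
          · exact h₃.digit_add_lt.le
      _ = g ^ 10 := by ring
  by_cases hZ0 : Z = 0
  · have hfac : d₂ ^ 2 * g ^ s * b = c * d₃ * (d₂ * g ^ n₂ + (d₂ + g - 1)) := by
      have hne : (g - 1) * a ≠ 0 := mul_ne_zero (by linarith) ha0.ne'
      refine mul_left_cancel₀ hne ?_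
      linear_combination d₂ ^ 2 * g ^ s * h₃.eq
        - d₃ * (d₂ * g ^ n₂ + (d₂ + g - 1)) * h₂.eq + d₂ ^ 2 * d₃ * hpow + hZ0
    have hmul : d₂ ^ 2 * g ^ s * (d₁ * g ^ n₁ - (d₁ + g - 1)) =
        (g - 1) * c ^ 2 * d₃ * (d₂ * g ^ n₂ + (d₂ + g - 1)) := by
      linear_combination (g - 1) * c * hfac - d₂ ^ 2 * g ^ s * h₁.eq
    have hn₁₂ : n₁ ≤ n₂ := h₁.length_le h₂ (by nlinarith)
    obtain ⟨k, hk⟩ := Nat.exists_eq_add_of_le hn₁₂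
    have hdvd : g ^ n₁ ∣ d₂ ^ 2 * g ^ s * (d₁ + g - 1) + (g - 1) * c ^ 2 * d₃ * (d₂ + g - 1) := by
      refine ⟨d₂ ^ 2 * g ^ s * d₁ - (g - 1) * c ^ 2 * d₃ * d₂ * g ^ k, ?_⟩
      rw [hk, pow_add] at hmul
      linear_combination -hmul
    have hc2 : c ^ 2 ≤ g ^ 7 := by
      have h1 : (a * a) * c ^ 2 < g ^ n₂ * g ^ n₂ := by
        calc (a * a) * c ^ 2 = (a * c) * (a * c) := by ring
          _ < g ^ n₂ * g ^ n₂ :=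
            mul_lt_mul'' h₂.lt_pow h₂.lt_pow (by positivity) (by positivity)
      have h2 : g ^ (n₃ - 1) * c ^ 2 < g ^ (n₃ - 1) * g ^ (s + 1) := by
        calc g ^ (n₃ - 1) * c ^ 2 ≤ (a * a) * c ^ 2 := by gcongr
          _ < g ^ n₂ * g ^ n₂ := h1
          _ = g ^ (n₃ - 1) * g ^ (s + 1) := by
            rw [← pow_add, ← pow_add]; congr 1; omega
      exact (lt_of_mul_lt_mul_left h2 (by positivity)).le.trans
        (pow_le_pow_right₀ hg1' (by omega))
    have hg0 : 0 < g - 1 := by linarith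
    have hle := Int.le_of_dvd (by positivity) hdvd
    have hn₁ : g ^ n₁ ≤ g ^ 12 := by
      have h1 : d₂ ^ 2 * g ^ s * (d₁ + g - 1) ≤ g ^ 2 * g ^ 6 * g ^ 2 := by
        gcongr
        · exact h₂.lt.le
        · exact h₁.digit_add_lt.le
      have h2 : (g - 1) * c ^ 2 * d₃ * (d₂ + g - 1) ≤ g * g ^ 7 * g * g ^ 2 := by
        gcongr
        · linarith
        · exact h₃.lt.le
        · exact h₂.digit_add_lt.le
      have h3 : g ^ 10 + g ^ 11 ≤ g ^ 12 := by
        have h10 : 0 < g ^ 10 := by positivity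
        have : 1 + g ≤ g ^ 2 := by nlinarith
        calc g ^ 10 + g ^ 11 = g ^ 10 * (1 + g) := by ring
          _ ≤ g ^ 10 * g ^ 2 := by gcongr
          _ = g ^ 12 := by ring
      calc g ^ n₁ ≤ _ := hle
        _ ≤ g ^ 2 * g ^ 6 * g ^ 2 + g * g ^ 7 * g * g ^ 2 := add_le_add h1 h2
        _ = g ^ 10 + g ^ 11 := by ring
        _ ≤ g ^ 12 := h3
    have hn₁' : n₁ ≤ 12 := (pow_le_pow_iff_right₀ hg1).1 hn₁
    have hlast : g ^ (n₃ - 1) < g ^ (n₁ + n₂) := by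
      calc g ^ (n₃ - 1) ≤ a * b := h₃.pow_le
        _ ≤ (a * b) * c ^ 2 := le_mul_of_one_le_right (by positivity) (one_le_pow₀ hc)
        _ = (b * c) * (a * c) := by ring
        _ < g ^ n₁ * g ^ n₂ :=
          mul_lt_mul'' h₁.lt_pow h₂.lt_pow (by positivity) (by positivity)
        _ = g ^ (n₁ + n₂) := (pow_add _ _ _).symm
    have := (pow_lt_pow_iff_right₀ hg1).1 hlast
    omega
  · have hdvd : a ∣ Z := by
      refine ⟨(g - 1) * (d₂ ^ 2 * g ^ s * b - d₃ * (d₂ * g ^ n₂ + (d₂ + g - 1)) * c), ?_⟩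
      rw [hZ]
      linear_combination -(d₂ ^ 2 * g ^ s * h₃.eq)
        + d₃ * (d₂ * g ^ n₂ + (d₂ + g - 1)) * h₂.eq - d₂ ^ 2 * d₃ * hpow
    have hle : a ≤ |Z| := Int.le_of_dvd (abs_pos.2 hZ0) ((dvd_abs _ _).2 hdvd)
    have hZle : |Z| ≤ g ^ 10 := by
      have h1 : 0 < d₃ * (d₂ + g - 1) ^ 2 := by positivity
      have h2 : 0 < d₂ ^ 2 * (d₃ + g - 1) * g ^ s := by positivity
      rw [abs_le]
      constructor <;> linarith
    have h10 : a ≤ g ^ 10 := hle.trans hZle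
    have hlast : g ^ (n₃ - 1) < g ^ 20 := by
      calc g ^ (n₃ - 1) < a * a := ha2
        _ ≤ g ^ 10 * g ^ 10 := mul_le_mul h10 h10 ha0.le (by positivity)
        _ = g ^ 20 := by ring
    have := (pow_lt_pow_iff_right₀ hg1).1 hlast
    omega

end IsRepdigitPred

theorem Repdigit.exists_isRepdigitPred {g x : ℕ} (h : Repdigit g (x + 1)) :
    ∃ (d n : ℕ), IsRepdigitPred g x d n := by
  obtain ⟨-, d, n, hd1, hd2, hn, h⟩ := h
  have hg : 1 ≤ g := by omega
  refine ⟨d, n, by exact_mod_cast hd1, by omega, hn, ?_⟩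
  zify [hg, Nat.one_le_pow n g hg] at h
  linear_combination h

/-! ### Counting triples -/

/-- The triple `p` has largest entry `q.2`, and the repdigit of length `q.1.1` with digit `q.1.2.2`
and some repdigit of length `q.1.2.1` are the values of its two largest products. -/
def TripleCode (g : ℕ) (p : ℕ × ℕ × ℕ) (q : (_ : ℕ × ℕ × ℕ) × ℕ) : Prop :=
  g ≤ q.2 ∧ 0 < q.2 ∧ q.2 = p.1 ∧
    IsRepdigitPred g ((q.2 : ℤ) * p.2.1) q.1.2.2 q.1.1 ∧
    ∃ d : ℕ, IsRepdigitPred g ((q.2 : ℤ) * p.2.2) d q.1.2.1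

theorem TripleCode.unique {g : ℕ} {p p' : ℕ × ℕ × ℕ} {q : (_ : ℕ × ℕ × ℕ) × ℕ}
    (h : TripleCode g p q) (h' : TripleCode g p' q) : p = p' := by
  obtain ⟨hga, ha, hp, hb, d, hc⟩ := h
  obtain ⟨-, -, hp', hb', d', hc'⟩ := h'
  have ha' : (q.2 : ℤ) ≠ 0 := by exact_mod_cast ha.ne'
  have hg : (g : ℤ) - 1 ≠ 0 := by linarith [hb.two_le_base]
  have hd := hc.eq_of_base_le hc' (by exact_mod_cast hga)
  have e1 := mul_left_cancel₀ ha' (mul_left_cancel₀ hg (hb.eq.trans hb'.eq.symm))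
  rw [← hd] at hc'
  have e2 := mul_left_cancel₀ ha' (mul_left_cancel₀ hg (hc.eq.trans hc'.eq.symm))
  exact Prod.ext (hp.symm.trans hp') (Prod.ext (by exact_mod_cast e1) (by exact_mod_cast e2))

/-- The codes that can occur for triples in base `g`. -/
def tripleCodes (g : ℕ) : Finset ((_ : ℕ × ℕ × ℕ) × ℕ) :=
  (Finset.range 31 ×ˢ Finset.range 31 ×ˢ Finset.range g).sigma
    fun q => (q.2.2 * (g ^ q.1 - 1) / (g - 1) - 1).divisors

theorem exists_tripleCode {g : ℕ} {p : ℕ × ℕ × ℕ} (hp : p ∈ DioTriples g) :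
    ∃ q ∈ tripleCodes g, TripleCode g p q := by
  obtain ⟨a, b, c⟩ := p
  obtain ⟨hc, hcb, hba, hab, hac, hbc⟩ := hp
  dsimp only at hc hcb hba hab hac hbc
  obtain ⟨d₃, n₃, h₃⟩ := hab.exists_isRepdigitPred
  obtain ⟨d₂, n₂, h₂⟩ := hac.exists_isRepdigitPred
  obtain ⟨d₁, n₁, h₁⟩ := hbc.exists_isRepdigitPred
  push_cast at h₁ h₂ h₃
  have hc' : (0 : ℤ) < c := by exact_mod_cast hc
  have hcb' : (c : ℤ) < b := by exact_mod_cast hcb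
  have hba' : (b : ℤ) < a := by exact_mod_cast hba
  have hn : n₂ < n₃ := lt_of_le_of_ne (h₂.length_le h₃ (by nlinarith))
    (h₃.length_ne h₂ hc' hcb' hba')
  have h30 := h₃.length_le_thirty h₂ h₁ hc' hcb' hba' hn
  have hg := h₃.two_le_base
  have hga : (g : ℤ) ≤ a := by
    have h1 : (g : ℤ) ^ 2 ≤ (g : ℤ) ^ (n₃ - 1) :=
      pow_le_pow_right₀ (by linarith) (by have := h₂.two_le; omega)
    have h2 := h₃.pow_le
    by_contra! hlt
    nlinarith
  have hd₃ : d₃ < g := by exact_mod_cast h₃.lt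
  have hg' : 2 ≤ g := by exact_mod_cast hg
  have hN : d₃ * (g ^ n₃ - 1) / (g - 1) = a * b + 1 := by
    refine Nat.div_eq_of_eq_mul_left (by omega) ?_
    zify [(by omega : 1 ≤ g), Nat.one_le_pow n₃ g (by omega)]
    linear_combination -h₃.eq
  refine ⟨⟨(n₃, n₂, d₃), a⟩, ?_, by exact_mod_cast hga, hc.trans (hcb.trans hba), rfl, h₃, d₂, h₂⟩
  simp only [tripleCodes, Finset.mem_sigma, Finset.mem_product, Finset.mem_range, hN,
    Nat.add_sub_cancel, Nat.mem_divisors]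
  exact ⟨⟨by omega, by omega, hd₃⟩, dvd_mul_right a b,
    Nat.mul_ne_zero (by omega) (by omega)⟩

theorem finite_dioTriples_and_card_le (g : ℕ) :
    (DioTriples g).Finite ∧ Nat.card (DioTriples g) ≤ (tripleCodes g).card := by
  have key : ∀ p ∈ DioTriples g, ∃ q ∈ tripleCodes g, TripleCode g p q :=
    fun _ => exists_tripleCode
  generalize tripleCodes g = T at key ⊢
  choose! f hf hcode using key
  have hmaps : Set.MapsTo f (DioTriples g) T := hf
  have hinj : Set.InjOn f (DioTriples g) := fun p hp p' hp' h =>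
    (hcode p hp).unique (h ▸ hcode p' hp')
  refine ⟨Set.Finite.of_injOn hmaps hinj T.finite_toSet, ?_⟩
  rw [Nat.card_coe_set_eq, ← Set.ncard_coe_finset]
  exact Set.ncard_le_ncard_of_injOn f hmaps hinj T.finite_toSet

theorem card_divisors_repdigit_le {g n d : ℕ} (hd : d < g) (hn : n ≤ 30) {C η : ℝ}
    (hC : 0 < C) (hη : 0 < η) (h : ∀ n : ℕ, (n.divisors.card : ℝ) ≤ C * (n : ℝ) ^ η) :
    ((d * (g ^ n - 1) / (g - 1) - 1).divisors.card : ℝ) ≤ C * (g : ℝ) ^ (30 * η) := by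
  have hle : d * (g ^ n - 1) / (g - 1) - 1 ≤ g ^ 30 := by
    have h1 : d * (g ^ n - 1) / (g - 1) ≤ g ^ n - 1 :=
      Nat.div_le_of_le_mul (Nat.mul_le_mul_right _ (by omega))
    have h2 : g ^ n ≤ g ^ 30 := Nat.pow_le_pow_right (by omega) hn
    omega
  refine (h _).trans (mul_le_mul_of_nonneg_left ?_ hC.le)
  calc ((d * (g ^ n - 1) / (g - 1) - 1 : ℕ) : ℝ) ^ η ≤ ((g : ℝ) ^ 30) ^ η :=
        Real.rpow_le_rpow (by positivity) (by exact_mod_cast hle) hη.le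
    _ = (g : ℝ) ^ (30 * η) := by
        rw [← Real.rpow_natCast, ← Real.rpow_mul (by positivity)]; norm_num

theorem card_tripleCodes_le (g : ℕ) {C η : ℝ} (hC : 0 < C) (hη : 0 < η)
    (h : ∀ n : ℕ, (n.divisors.card : ℝ) ≤ C * (n : ℝ) ^ η) :
    ((tripleCodes g).card : ℝ) ≤ 961 * C * ((g : ℝ) * (g : ℝ) ^ (30 * η)) := by
  rw [tripleCodes, Finset.card_sigma, Nat.cast_sum]
  refine (Finset.sum_le_card_nsmul _ _ (C * (g : ℝ) ^ (30 * η)) ?_).trans_eq ?_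
  · simp only [Finset.mem_product, Finset.mem_range]
    exact fun q hq => card_divisors_repdigit_le hq.2.2 (by omega) hC hη h
  · simp only [Finset.card_product, Finset.card_range, nsmul_eq_mul]
    push_cast
    ring

theorem stmt_18 (ε : ℝ) (hε : 0 < ε) :
    ∃ G : ℕ, ∀ g : ℕ, G ≤ g →
      (DioTriples g).Finite ∧
      (Nat.card (DioTriples g) : ℝ) ≤ (g : ℝ) ^ ((1 : ℝ) + ε) := by
  obtain ⟨C, hC, hdiv⟩ := exists_card_divisors_le_rpow (by positivity : 0 < ε / 60)
  have hlim : Filter.Tendsto (fun g : ℕ => (g : ℝ) ^ (ε / 2)) Filter.atTop Filter.atTop :=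
    (tendsto_rpow_atTop (by positivity)).comp tendsto_natCast_atTop_atTop
  obtain ⟨G, hG⟩ := Filter.eventually_atTop.1 (hlim.eventually_ge_atTop (961 * C))
  refine ⟨max G 2, fun g hg => ?_⟩
  have hg2 : 2 ≤ g := (le_max_right _ _).trans hg
  have hg0 : (0 : ℝ) < g := by exact_mod_cast (by omega : 0 < g)
  obtain ⟨hfin, hcard⟩ := finite_dioTriples_and_card_le g
  refine ⟨hfin, ?_⟩
  calc (Nat.card (DioTriples g) : ℝ) ≤ ((tripleCodes g).card : ℝ) := by exact_mod_cast hcard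
    _ ≤ 961 * C * ((g : ℝ) * (g : ℝ) ^ (30 * (ε / 60))) :=
      card_tripleCodes_le g hC (by positivity) hdiv
    _ ≤ (g : ℝ) ^ (ε / 2) * ((g : ℝ) * (g : ℝ) ^ (30 * (ε / 60))) := by
      gcongr
      exact hG g ((le_max_left _ _).trans hg)
    _ = (g : ℝ) ^ ((1 : ℝ) + ε) := by
      rw [Real.rpow_add hg0, Real.rpow_one, mul_left_comm, ← Real.rpow_add hg0]
      ring_nf
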